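/- arXiv:1202.0763 — 2 statements merged into one kernel-verified Lean document; each statement's English description precedes it below -/
import Mathlib

section
/- For every complex number s with Re(s) > 1, one has p₁(s) · p₂(2s) / p₂(s) = L(s,χ), where L(s,χ) is the Dirichlet L-function of χ. -/
open Complex NumberField Filter

noncomputable section

/-- The partial Euler product `∏_{p prime, χ(p) = ε} (1 - p^{-s})⁻¹`. -/
def eulerProd {d : ℕ} (χ : DirichletCharacter ℂ d) (ε : ℂ) (s : ℂ) : ℂ :=
  ∏' p : {p : Nat.Primes // χ ((p : Nat.Primes) : ℕ) = ε}, (1 - (((p : Nat.Primes) : ℕ) : ℂ) ^ (-s))⁻¹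

/-- `χ` is the Dirichlet character attached to the quadratic field `K`, i.e. the real
primitive quadratic character mod `d = |Δ_K|` given by the Kronecker symbol `(Δ_K/·)`:
at odd primes it is given by the Legendre symbol `(Δ_K/p)` and at `2` (when `2 ∤ d`)
by `χ₈(Δ_K)`. -/
def IsKroneckerCharacter (K : Type*) [Field K] [NumberField K] {d : ℕ}
    (χ : DirichletCharacter ℂ d) : Prop :=
  d = (NumberField.discr K).natAbs ∧ χ.IsPrimitive ∧ MulChar.IsQuadratic χ ∧
  (∀ (p : ℕ) (hp : p.Prime), p ≠ 2 →
    χ (p : ZMod d) = ((@legendreSym p ⟨hp⟩ (NumberField.discr K) : ℤ) : ℂ)) ∧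
  (¬ (2 : ℕ) ∣ d → χ ((2 : ℕ) : ZMod d) = ((ZMod.χ₈ ((NumberField.discr K : ℤ) : ZMod 8) : ℤ) : ℂ))

/-- For `Re s > 1`, the factors `1 - p^{-s}` do not vanish. -/
lemma one_sub_prime_cpow_neg_ne_zero {s : ℂ} (hs : 1 < s.re) (p : Nat.Primes) :
    1 - ((p : ℕ) : ℂ) ^ (-s) ≠ 0 := by
  have hlt : ‖((p : ℕ) : ℂ) ^ (-s)‖ < 1 := by
    rw [norm_natCast_cpow_of_pos p.prop.pos]
    exact Real.rpow_lt_one_of_one_lt_of_neg (by exact_mod_cast p.prop.one_lt)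
      (by rw [neg_re]; linarith)
  intro h
  rw [← sub_eq_zero.mp h, norm_one] at hlt
  exact lt_irrefl _ hlt

lemma summable_norm_prime_cpow_neg {s : ℂ} (hs : 1 < s.re) :
    Summable fun p : Nat.Primes ↦ ‖((p : ℕ) : ℂ) ^ (-s)‖ := by
  refine (Nat.Primes.summable_rpow.mpr (neg_lt_neg hs)).congr fun p ↦ ?_
  rw [norm_natCast_cpow_of_pos p.prop.pos, neg_re]

/-- The Euler product of `1 - p^{-s}` over a set of primes converges to a nonzero value. -/
lemma multipliable_and_tprod_one_sub_prime_cpow_ne_zero {s : ℂ} (hs : 1 < s.re)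
    (P : Nat.Primes → Prop) :
    (Multipliable fun p : {p // P p} ↦ 1 - (((p : Nat.Primes) : ℕ) : ℂ) ^ (-s)) ∧
      ∏' p : {p // P p}, (1 - (((p : Nat.Primes) : ℕ) : ℂ) ^ (-s)) ≠ 0 := by
  have hsum : Summable fun p : {p // P p} ↦ ‖-(((p : Nat.Primes) : ℕ) : ℂ) ^ (-s)‖ := by
    simp only [norm_neg]
    exact (summable_norm_prime_cpow_neg hs).comp_injective Subtype.val_injective
  simp only [sub_eq_add_neg (1 : ℂ)]
  refine ⟨multipliable_one_add_of_summable hsum, tprod_one_add_ne_zero_of_summable ?_ hsum⟩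
  intro p
  rw [← sub_eq_add_neg]
  exact one_sub_prime_cpow_neg_ne_zero hs p

lemma eulerProd_ne_zero {d : ℕ} (χ : DirichletCharacter ℂ d) (ε : ℂ) {s : ℂ} (hs : 1 < s.re) :
    eulerProd χ ε s ≠ 0 := by
  obtain ⟨hm, h0⟩ := multipliable_and_tprod_one_sub_prime_cpow_ne_zero hs
    fun p ↦ χ ((p : ℕ) : ZMod d) = ε
  rw [eulerProd, hm.tprod_inv₀ h0]
  exact inv_ne_zero h0

/-- `eulerProd` as an unconditionally convergent product over all primes. -/
lemma hasProd_eulerProd {d : ℕ} (χ : DirichletCharacter ℂ d) (ε : ℂ) {s : ℂ} (hs : 1 < s.re) :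
    HasProd ({p : Nat.Primes | χ ((p : ℕ) : ZMod d) = ε}.mulIndicator
      fun p ↦ (1 - ((p : ℕ) : ℂ) ^ (-s))⁻¹) (eulerProd χ ε s) := by
  obtain ⟨hm, h0⟩ := multipliable_and_tprod_one_sub_prime_cpow_ne_zero hs
    fun p ↦ χ ((p : ℕ) : ZMod d) = ε
  exact hasProd_subtype_iff_mulIndicator.mp (hm.inv₀ h0).hasProd

/-- The factorization of the `L`-function of a quadratic Dirichlet character into partial Euler
products. -/
lemma eulerProd_mul_eulerProd_eq_LFunction_mul {d : ℕ} [NeZero d] {χ : DirichletCharacter ℂ d}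
    (hχ : MulChar.IsQuadratic χ) {s : ℂ} (hs : 1 < s.re) :
    eulerProd χ 1 s * eulerProd χ (-1) (2 * s) =
      DirichletCharacter.LFunction χ s * eulerProd χ (-1) s := by
  have hs2 : 1 < (2 * s).re := by
    have h : (2 * s).re = 2 * s.re := by simp
    linarith
  rw [DirichletCharacter.LFunction_eq_LSeries χ hs]
  refine ((hasProd_eulerProd χ 1 hs).mul (hasProd_eulerProd χ (-1) hs2)).unique ?_
  convert! (DirichletCharacter.LSeries_eulerProduct_hasProd χ hs).mul
    (hasProd_eulerProd χ (-1) hs) using 2 with p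
  have hsq : ((p : ℕ) : ℂ) ^ (-(2 * s)) = (((p : ℕ) : ℂ) ^ (-s)) ^ 2 := by
    rw [← cpow_nat_mul]
    congr 1
    push_cast
    ring
  have h1 : (1 : ℂ) ≠ -1 := by norm_num
  simp only [Set.mulIndicator_apply, Set.mem_ofPred_eq]
  rcases hχ (p : ℕ) with h | h | h
  · simp [h]
  · simp [h, h1]
  · simp only [h, h1.symm, if_true, if_false, hsq, one_mul, ← mul_inv]
    congr 1
    ring

/-- `p₁(s) ⬝ p₂(2s) / p₂(s) = L(s,χ)` for `Re s > 1`. -/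
theorem statement3 (K : Type*) [Field K] [NumberField K]
    (hK : Module.finrank ℚ K = 2) {d : ℕ} [NeZero d] (χ : DirichletCharacter ℂ d)
    (hχ : IsKroneckerCharacter K χ)
    (s : ℂ) (hs : 1 < s.re) :
    eulerProd χ 1 s * eulerProd χ (-1) (2 * s) / eulerProd χ (-1) s =
      DirichletCharacter.LFunction χ s := by
  rw [div_eq_iff (eulerProd_ne_zero χ (-1) hs)]
  exact eulerProd_mul_eulerProd_eq_LFunction_mul hχ.2.2.1 hs
end
end

section
/- For i = 1, 2 and every complex number s with Re(s) ≥ 1, the truncated series approximates pᵢ(2s) with error o(2^{-2ⁿ}): lim_{n→∞} 2^{2ⁿ} · ( pᵢ(2s) − exp(−∑_{k=1}^{n} (1/2^k) log qᵢ(2^k s)) ) = 0, where log denotes the principal branch of the complex logarithm. -/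
open Complex NumberField Filter

noncomputable section

/-- `q₁(s) = ζ(2s)/(ζ(s)L(s,χ)) ∏_{p|d} (1+p^{-s})`. -/
def qOne {d : ℕ} [NeZero d] (χ : DirichletCharacter ℂ d) (s : ℂ) : ℂ :=
  riemannZeta (2 * s) / (riemannZeta s * DirichletCharacter.LFunction χ s) *
    ∏ p ∈ d.primeFactors, (1 + (p : ℂ) ^ (-s))

/-- `q₂(s) = L(s,χ)/ζ(s) ∏_{p|d} (1-p^{-s})⁻¹`. -/
def qTwo {d : ℕ} [NeZero d] (χ : DirichletCharacter ℂ d) (s : ℂ) : ℂ :=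
  DirichletCharacter.LFunction χ s / riemannZeta s *
    ∏ p ∈ d.primeFactors, (1 - (p : ℂ) ^ (-s))⁻¹

/-- The logarithm `∑_{p ∈ A} -log (1 - p^{-s})` of the Euler product over a set `A` of primes. -/
def logEulerSum (A : Set Nat.Primes) (s : ℂ) : ℂ :=
  ∑' p : Nat.Primes, A.indicator (fun p => -Complex.log (1 - (p : ℂ) ^ (-s))) p

theorem Nat.Primes.summable_inv_sq : Summable fun p : Nat.Primes => ((p : ℝ) ^ 2)⁻¹ := by
  have h := Nat.Primes.summable_rpow.mpr (show (-2 : ℝ) < -1 by norm_num)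
  refine h.congr fun p => ?_
  rw [Real.rpow_neg (Nat.cast_nonneg _)]
  norm_cast

theorem Nat.Primes.tsum_inv_sq_le : ∑' p : Nat.Primes, ((p : ℝ) ^ 2)⁻¹ ≤ 2 / 3 := by
  have h : HasSum (fun n : ℕ => 1 / ((n + 2 : ℕ) : ℝ) ^ 2) (Real.pi ^ 2 / 6 - 1) := by
    have := (hasSum_nat_add_iff' 2).mpr hasSum_zeta_two
    simpa [Finset.sum_range_succ] using this
  have hinj : Function.Injective fun p : Nat.Primes => (p : ℕ) - 2 := by
    intro p q hpq
    have hp := p.prop.two_le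
    have hq := q.prop.two_le
    apply Subtype.ext
    simp only at hpq
    omega
  have hle := tsum_comp_le_tsum_of_inj h.summable (fun n => by positivity) hinj
  rw [h.tsum_eq] at hle
  have hπ : Real.pi ^ 2 ≤ 10 := by nlinarith [Real.pi_lt_d2, Real.pi_pos]
  calc ∑' p : Nat.Primes, ((p : ℝ) ^ 2)⁻¹
      = tsum ((fun n : ℕ => 1 / ((n + 2 : ℕ) : ℝ) ^ 2) ∘ fun p : Nat.Primes => (p : ℕ) - 2) := by
        refine tsum_congr fun p => ?_
        simp only [Function.comp_apply, Nat.sub_add_cancel p.prop.two_le, one_div]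
    _ ≤ _ := by linarith

theorem Nat.Primes.norm_cpow_neg_le {s : ℂ} (hs : 2 ≤ s.re) (p : Nat.Primes) :
    ‖(p : ℂ) ^ (-s)‖ ≤ (2 : ℝ) ^ (2 - s.re) * ((p : ℝ) ^ 2)⁻¹ := by
  have hp : (0 : ℝ) < p := mod_cast p.prop.pos
  have h2 : (2 : ℝ) ≤ p := mod_cast p.prop.two_le
  rw [Complex.norm_natCast_cpow_of_pos p.prop.pos, Complex.neg_re,
    show -s.re = (2 - s.re) + (-2) by ring, Real.rpow_add hp,
    Real.rpow_neg hp.le, show (p : ℝ) ^ (2 : ℝ) = (p : ℝ) ^ 2 by norm_cast]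
  gcongr ?_ * _
  exact Real.rpow_le_rpow_of_nonpos two_pos h2 (by linarith)

theorem Nat.Primes.norm_cpow_neg_le_half {s : ℂ} (hs : 2 ≤ s.re) (p : Nat.Primes) :
    ‖(p : ℂ) ^ (-s)‖ ≤ 1 / 2 := by
  refine (norm_cpow_neg_le hs p).trans ?_
  have h1 : (2 : ℝ) ^ (2 - s.re) ≤ 1 :=
    Real.rpow_le_one_of_one_le_of_nonpos one_le_two (by linarith)
  have h2 : (2 : ℝ) ≤ p := mod_cast p.prop.two_le
  have h3 : ((p : ℝ) ^ 2)⁻¹ ≤ (2 ^ 2)⁻¹ := by gcongr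
  have h4 : 0 ≤ ((p : ℝ) ^ 2)⁻¹ := by positivity
  nlinarith

theorem Nat.Primes.one_sub_cpow_neg_ne_zero {s : ℂ} (hs : 2 ≤ s.re) (p : Nat.Primes) :
    1 - (p : ℂ) ^ (-s) ≠ 0 := by
  intro h
  have h1 := norm_cpow_neg_le_half hs p
  rw [← sub_eq_zero.mp h, norm_one] at h1
  norm_num at h1

theorem Nat.Primes.one_add_cpow_neg_ne_zero {s : ℂ} (hs : 2 ≤ s.re) (p : Nat.Primes) :
    1 + (p : ℂ) ^ (-s) ≠ 0 := by
  intro h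
  have h1 := norm_cpow_neg_le_half hs p
  rw [← neg_eq_of_add_eq_zero_right h, norm_neg, norm_one] at h1
  norm_num at h1

theorem norm_indicator_neg_log_le (A : Set Nat.Primes) {s : ℂ} (hs : 2 ≤ s.re) (p : Nat.Primes) :
    ‖A.indicator (fun p : Nat.Primes => -Complex.log (1 - (p : ℂ) ^ (-s))) p‖ ≤
      3 / 2 * (2 : ℝ) ^ (2 - s.re) * ((p : ℝ) ^ 2)⁻¹ := by
  refine (norm_indicator_le_norm_self _ _).trans ?_
  have h := Complex.norm_log_one_add_half_le_self
    (by simpa using Nat.Primes.norm_cpow_neg_le_half hs p : ‖-(p : ℂ) ^ (-s)‖ ≤ 1 / 2)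
  rw [norm_neg, ← sub_eq_add_neg] at h
  rw [norm_neg]
  linarith [Nat.Primes.norm_cpow_neg_le hs p]

theorem summable_indicator_neg_log (A : Set Nat.Primes) {s : ℂ} (hs : 2 ≤ s.re) :
    Summable (A.indicator fun p : Nat.Primes => -Complex.log (1 - (p : ℂ) ^ (-s))) :=
  (Nat.Primes.summable_inv_sq.mul_left _).of_norm_bounded (norm_indicator_neg_log_le A hs)

theorem norm_logEulerSum_le (A : Set Nat.Primes) {s : ℂ} (hs : 2 ≤ s.re) :
    ‖logEulerSum A s‖ ≤ (2 : ℝ) ^ (2 - s.re) := by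
  refine (tsum_of_norm_bounded (Nat.Primes.summable_inv_sq.mul_left _).hasSum
    (norm_indicator_neg_log_le A hs)).trans ?_
  rw [tsum_mul_left]
  have := Nat.Primes.tsum_inv_sq_le
  have h : (0 : ℝ) < 2 ^ (2 - s.re) := by positivity
  nlinarith

theorem hasProd_exp_logEulerSum (A : Set Nat.Primes) {s : ℂ} (hs : 2 ≤ s.re) :
    HasProd (A.mulIndicator fun p : Nat.Primes => (1 - (p : ℂ) ^ (-s))⁻¹)
      (Complex.exp (logEulerSum A s)) := by
  have h : HasSum _ (logEulerSum A s) := (summable_indicator_neg_log A hs).hasSum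
  refine h.cexp.congr fun F => Finset.prod_congr rfl fun p _ => ?_
  by_cases hp : p ∈ A
  · simp [hp, Complex.exp_neg, Complex.exp_log (Nat.Primes.one_sub_cpow_neg_ne_zero hs p)]
  · simp [hp]

theorem eulerProd_eq_exp {d : ℕ} (χ : DirichletCharacter ℂ d) (ε : ℂ) {s : ℂ} (hs : 2 ≤ s.re) :
    eulerProd χ ε s =
      Complex.exp (logEulerSum {p : Nat.Primes | χ ((p : ℕ) : ZMod d) = ε} s) :=
  (hasProd_subtype_iff_mulIndicator.mpr (hasProd_exp_logEulerSum _ hs)).tprod_eq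

/-- Since `‖logEulerSum A (2s) - 2 logEulerSum A s‖ ≤ 3 < π`, the principal logarithm
recovers it from its exponential. -/
theorem log_exp_logEulerSum (A : Set Nat.Primes) {s : ℂ} (hs : 2 ≤ s.re) :
    Complex.log (Complex.exp (logEulerSum A (2 * s) - 2 * logEulerSum A s)) =
      logEulerSum A (2 * s) - 2 * logEulerSum A s := by
  have h2 : (2 * s).re = 2 * s.re := by simp
  have hb (w : ℂ) (hw : 2 ≤ w.re) : ‖logEulerSum A w‖ ≤ 1 :=
    (norm_logEulerSum_le A hw).trans
      (Real.rpow_le_one_of_one_le_of_nonpos one_le_two (by linarith))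
  have hnorm : ‖logEulerSum A (2 * s) - 2 * logEulerSum A s‖ ≤ 3 := by
    refine (norm_sub_le _ _).trans ?_
    rw [norm_mul, Complex.norm_two]
    linarith [hb s hs, hb (2 * s) (by linarith)]
  have him := abs_le.mp ((Complex.abs_im_le_norm _).trans hnorm)
  exact Complex.log_exp (by linarith [Real.pi_gt_three]) (by linarith [Real.pi_gt_three])

theorem hasProd_primeFactors (d : ℕ) [NeZero d] (f : ℕ → ℂ) :
    HasProd ({p : Nat.Primes | (p : ℕ) ∣ d}.mulIndicator fun p => f p)
      (∏ p ∈ d.primeFactors, f p) := by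
  have h := hasProd_prod_of_ne_finset_one (L := SummationFilter.unconditional Nat.Primes)
    (f := {p : Nat.Primes | (p : ℕ) ∣ d}.mulIndicator fun p => f p)
    (s := d.primeFactors.subtype Nat.Prime) (fun p hp => by
      refine Set.mulIndicator_of_notMem (fun hd => hp ?_) _
      exact Finset.mem_subtype.mpr (Nat.mem_primeFactors.mpr ⟨p.prop, hd, NeZero.ne d⟩))
  convert h using 1
  rw [← Finset.prod_subtype_of_mem (p := Nat.Prime) f fun p hp => Nat.prime_of_mem_primeFactors hp]
  refine Finset.prod_congr rfl fun p hp => ?_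
  exact (Set.mulIndicator_of_mem (s := {p : Nat.Primes | (p : ℕ) ∣ d})
    (Nat.dvd_of_mem_primeFactors (Finset.mem_subtype.mp hp)) fun p : Nat.Primes => f p).symm

theorem DirichletCharacter.map_prime_eq_zero_iff {d : ℕ} (χ : DirichletCharacter ℂ d)
    (p : Nat.Primes) : χ ((p : ℕ) : ZMod d) = 0 ↔ (p : ℕ) ∣ d := by
  rw [← not_iff_not, ← p.prop.coprime_iff_not_dvd, ← ZMod.isUnit_iff_coprime]
  exact ⟨fun h => not_not.mp fun hu => h (χ.map_nonunit hu), fun h => (h.map χ).ne_zero⟩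

theorem DirichletCharacter.hasProd_LFunction {d : ℕ} [NeZero d] (χ : DirichletCharacter ℂ d)
    {s : ℂ} (hs : 1 < s.re) :
    HasProd (fun p : Nat.Primes => (1 - χ ((p : ℕ) : ZMod d) * (p : ℂ) ^ (-s))⁻¹)
      (DirichletCharacter.LFunction χ s) := by
  rw [DirichletCharacter.LFunction_eq_LSeries χ hs]
  exact DirichletCharacter.LSeries_eulerProduct_hasProd χ hs

theorem DirichletCharacter.LFunction_ne_zero_of_one_lt_re {d : ℕ} [NeZero d]
    (χ : DirichletCharacter ℂ d) {s : ℂ} (hs : 1 < s.re) :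
    DirichletCharacter.LFunction χ s ≠ 0 := by
  rw [DirichletCharacter.LFunction_eq_LSeries χ hs,
    ← DirichletCharacter.LSeries_eulerProduct_exp_log χ hs]
  exact Complex.exp_ne_zero _

theorem natCast_cpow_neg_two_mul (p : ℕ) (s : ℂ) :
    (p : ℂ) ^ (-(2 * s)) = ((p : ℂ) ^ (-s)) ^ 2 := by
  rw [← Complex.cpow_nat_mul]
  congr 1
  push_cast
  ring

theorem qOne_eq_exp {d : ℕ} [NeZero d] {χ : DirichletCharacter ℂ d} (hχ : MulChar.IsQuadratic χ)
    {s : ℂ} (hs : 2 ≤ s.re) :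
    qOne χ s = Complex.exp (logEulerSum {p : Nat.Primes | χ ((p : ℕ) : ZMod d) = 1} (2 * s) -
      2 * logEulerSum {p : Nat.Primes | χ ((p : ℕ) : ZMod d) = 1} s) := by
  set A : Set Nat.Primes := {p : Nat.Primes | χ ((p : ℕ) : ZMod d) = 1} with hA
  have hs1 : 1 < s.re := by linarith
  have h2 : 2 ≤ (2 * s).re := by simp; linarith
  have hE := hasProd_exp_logEulerSum A hs
  have hl := (hasProd_exp_logEulerSum A h2).mul
    ((riemannZeta_eulerProduct_hasProd hs1).mul (χ.hasProd_LFunction hs1))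
  have hr := ((riemannZeta_eulerProduct_hasProd (by linarith : 1 < (2 * s).re)).mul
    (hasProd_primeFactors d fun p => 1 + (p : ℂ) ^ (-s))).mul (hE.mul hE)
  have key := hl.unique (hr.congr fun F => Finset.prod_congr rfl fun p _ => ?_)
  · have hζ := riemannZeta_ne_zero_of_one_lt_re hs1
    have hL := χ.LFunction_ne_zero_of_one_lt_re hs1
    have hexp := Complex.exp_ne_zero (logEulerSum A s)
    rw [qOne, Complex.exp_sub, two_mul (logEulerSum A s), Complex.exp_add]
    field_simp
    linear_combination -key
  · have h1 := Nat.Primes.one_sub_cpow_neg_ne_zero hs p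
    have h2 := Nat.Primes.one_add_cpow_neg_ne_zero hs p
    have hd := χ.map_prime_eq_zero_iff p
    simp only [Set.mulIndicator, hA, Set.mem_ofPred_eq, ← hd, natCast_cpow_neg_two_mul]
    generalize (p : ℂ) ^ (-s) = z at h1 h2
    have hz : 1 - z ^ 2 = (1 - z) * (1 + z) := by ring
    rw [hz]
    rcases hχ ((p : ℕ) : ZMod d) with h | h | h <;> rw [h] <;> norm_num <;> field_simp

theorem qTwo_eq_exp {d : ℕ} [NeZero d] {χ : DirichletCharacter ℂ d} (hχ : MulChar.IsQuadratic χ)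
    {s : ℂ} (hs : 2 ≤ s.re) :
    qTwo χ s = Complex.exp (logEulerSum {p : Nat.Primes | χ ((p : ℕ) : ZMod d) = -1} (2 * s) -
      2 * logEulerSum {p : Nat.Primes | χ ((p : ℕ) : ZMod d) = -1} s) := by
  set A : Set Nat.Primes := {p : Nat.Primes | χ ((p : ℕ) : ZMod d) = -1} with hA
  have hs1 : 1 < s.re := by linarith
  have h2 : 2 ≤ (2 * s).re := by simp; linarith
  have hE := hasProd_exp_logEulerSum A hs
  have hl := (hasProd_exp_logEulerSum A h2).mul (riemannZeta_eulerProduct_hasProd hs1)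
  have hr := ((χ.hasProd_LFunction hs1).mul
    (hasProd_primeFactors d fun p => (1 - (p : ℂ) ^ (-s))⁻¹)).mul (hE.mul hE)
  have key := hl.unique (hr.congr fun F => Finset.prod_congr rfl fun p _ => ?_)
  · have hζ := riemannZeta_ne_zero_of_one_lt_re hs1
    have hexp := Complex.exp_ne_zero (logEulerSum A s)
    rw [qTwo, Complex.exp_sub, two_mul (logEulerSum A s), Complex.exp_add,
      div_mul_eq_mul_div, div_eq_div_iff hζ (mul_ne_zero hexp hexp)]
    linear_combination -key
  · have h1 := Nat.Primes.one_sub_cpow_neg_ne_zero hs p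
    have h2 := Nat.Primes.one_add_cpow_neg_ne_zero hs p
    have hd := χ.map_prime_eq_zero_iff p
    simp only [Set.mulIndicator, hA, Set.mem_ofPred_eq, ← hd, natCast_cpow_neg_two_mul]
    generalize (p : ℂ) ^ (-s) = z at h1 h2
    have hz : 1 - z ^ 2 = (1 - z) * (1 + z) := by ring
    rw [hz]
    rcases hχ ((p : ℕ) : ZMod d) with h | h | h <;> rw [h] <;> norm_num <;> field_simp

theorem le_re_two_pow_mul {s : ℂ} (hs : 1 ≤ s.re) (k : ℕ) :
    (2 : ℝ) ^ k ≤ ((2 : ℂ) ^ k * s).re := by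
  have h : ((2 : ℂ) ^ k * s).re = 2 ^ k * s.re := by
    rw [show (2 : ℂ) ^ k = ((2 ^ k : ℝ) : ℂ) by push_cast; rfl, Complex.re_ofReal_mul]
  rw [h]
  exact le_mul_of_one_le_right (by positivity) hs

theorem two_le_re_two_pow_mul {s : ℂ} (hs : 1 ≤ s.re) {k : ℕ} (hk : k ≠ 0) :
    2 ≤ ((2 : ℂ) ^ k * s).re :=
  (le_self_pow₀ one_le_two hk).trans (le_re_two_pow_mul hs k)

theorem sum_log_eq_logEulerSum {A : Set Nat.Primes} {q : ℂ → ℂ}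
    (hq : ∀ w : ℂ, 2 ≤ w.re → q w = Complex.exp (logEulerSum A (2 * w) - 2 * logEulerSum A w))
    {s : ℂ} (hs : 1 ≤ s.re) (n : ℕ) :
    ∑ k ∈ Finset.Icc 1 n, (1 / (2 : ℂ) ^ k) * Complex.log (q ((2 : ℂ) ^ k * s)) =
      (1 / (2 : ℂ) ^ n) * logEulerSum A ((2 : ℂ) ^ (n + 1) * s) - logEulerSum A (2 * s) := by
  induction n with
  | zero => simp
  | succ n ih =>
    have h := two_le_re_two_pow_mul hs n.succ_ne_zero
    rw [Finset.sum_Icc_succ_top (by omega), ih, hq _ h, log_exp_logEulerSum A h, ← mul_assoc 2,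
      ← pow_succ']
    field_simp
    ring

theorem tendsto_two_pow_mul_exp_logEulerSum_sub {A : Set Nat.Primes} {q : ℂ → ℂ}
    (hq : ∀ w : ℂ, 2 ≤ w.re → q w = Complex.exp (logEulerSum A (2 * w) - 2 * logEulerSum A w))
    {s : ℂ} (hs : 1 ≤ s.re) :
    Tendsto (fun n : ℕ => (2 : ℂ) ^ (2 ^ n) * (Complex.exp (logEulerSum A (2 * s)) -
      Complex.exp (-∑ k ∈ Finset.Icc 1 n, (1 / (2 : ℂ) ^ k) * Complex.log (q ((2 : ℂ) ^ k * s)))))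
      atTop (nhds 0) := by
  have hlim : Tendsto (fun n : ℕ => 8 * ‖Complex.exp (logEulerSum A (2 * s))‖ *
      (1 / 2 : ℝ) ^ (2 ^ n)) atTop (nhds 0) := by
    have h := (tendsto_pow_atTop_nhds_zero_of_lt_one (by norm_num : (0 : ℝ) ≤ 1 / 2)
      (by norm_num)).comp (tendsto_pow_atTop_atTop_of_one_lt (one_lt_two : (1 : ℕ) < 2))
    simpa using h.const_mul (8 * ‖Complex.exp (logEulerSum A (2 * s))‖)
  refine squeeze_zero_norm (fun n => ?_) hlim
  set x : ℂ := (1 / (2 : ℂ) ^ n) * logEulerSum A ((2 : ℂ) ^ (n + 1) * s) with hx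
  have hre := two_le_re_two_pow_mul hs n.succ_ne_zero
  have hxP : ‖x‖ ≤ ‖logEulerSum A ((2 : ℂ) ^ (n + 1) * s)‖ := by
    rw [hx, norm_mul]
    refine mul_le_of_le_one_left (norm_nonneg _) ?_
    rw [norm_div, norm_pow, norm_one, Complex.norm_two]
    exact div_le_one_of_le₀ (one_le_pow₀ one_le_two) (by positivity)
  have hx2 := hxP.trans (norm_logEulerSum_le A hre)
  have hx1 : ‖-x‖ ≤ 1 := by
    rw [norm_neg]
    exact hx2.trans (Real.rpow_le_one_of_one_le_of_nonpos one_le_two (by linarith))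
  have hx4 : ‖x‖ ≤ 4 * ((1 / 2 : ℝ) ^ (2 ^ n)) ^ 2 := by
    refine hx2.trans ((Real.rpow_le_rpow_of_exponent_le one_le_two
      (sub_le_sub_left (le_re_two_pow_mul hs (n + 1)) 2)).trans_eq ?_)
    rw [← pow_mul, ← pow_succ, Real.rpow_sub two_pos, one_div, inv_pow, ← div_eq_mul_inv]
    norm_cast
  rw [sum_log_eq_logEulerSum hq hs, ← hx,
    show -(x - logEulerSum A (2 * s)) = logEulerSum A (2 * s) + -x by ring, Complex.exp_add,
    show ∀ a b : ℂ, a - a * b = -(a * (b - 1)) by intros; ring,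
    norm_mul, norm_neg, norm_mul, norm_pow, Complex.norm_two]
  have hexp := Complex.norm_exp_sub_one_le hx1
  rw [norm_neg] at hexp
  have hpow : (2 : ℝ) ^ (2 ^ n) * (1 / 2 : ℝ) ^ (2 ^ n) = 1 := by
    rw [← mul_pow]
    norm_num
  calc (2 : ℝ) ^ (2 ^ n) * (‖Complex.exp (logEulerSum A (2 * s))‖ * ‖Complex.exp (-x) - 1‖)
      ≤ (2 : ℝ) ^ (2 ^ n) * (‖Complex.exp (logEulerSum A (2 * s))‖ *
        (2 * (4 * ((1 / 2 : ℝ) ^ (2 ^ n)) ^ 2))) := by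
        gcongr
        linarith
    _ = 8 * ‖Complex.exp (logEulerSum A (2 * s))‖ * (1 / 2 : ℝ) ^ (2 ^ n) := by
        linear_combination
          8 * ‖Complex.exp (logEulerSum A (2 * s))‖ * (1 / 2 : ℝ) ^ (2 ^ n) * hpow

/-- For `Re s ≥ 1` and `i = 1, 2`, the truncation of the series approximates `pᵢ(2s)`
with error `o(2^(-2ⁿ))`:
`2^(2ⁿ) ⬝ (pᵢ(2s) − exp(−∑_{k=1}^{n} (1/2^k) log qᵢ(2^k s))) → 0` as `n → ∞`. -/
theorem statement17 (K : Type*) [Field K] [NumberField K]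
    (hK : Module.finrank ℚ K = 2) {d : ℕ} [NeZero d] (χ : DirichletCharacter ℂ d)
    (hχ : IsKroneckerCharacter K χ)
    (s : ℂ) (hs : 1 ≤ s.re) :
    Tendsto (fun n : ℕ => (2 : ℂ) ^ (2 ^ n) *
      (eulerProd χ 1 (2 * s) -
        Complex.exp (-∑ k ∈ Finset.Icc 1 n, (1 / (2 : ℂ) ^ k) * Complex.log (qOne χ ((2 : ℂ) ^ k * s)))))
      atTop (nhds 0) ∧
    Tendsto (fun n : ℕ => (2 : ℂ) ^ (2 ^ n) *
      (eulerProd χ (-1) (2 * s) -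
        Complex.exp (-∑ k ∈ Finset.Icc 1 n, (1 / (2 : ℂ) ^ k) * Complex.log (qTwo χ ((2 : ℂ) ^ k * s)))))
      atTop (nhds 0) := by
  have h2 : 2 ≤ (2 * s).re := by simpa using hs
  rw [eulerProd_eq_exp χ 1 h2, eulerProd_eq_exp χ (-1) h2]
  exact ⟨tendsto_two_pow_mul_exp_logEulerSum_sub (fun _ => qOne_eq_exp hχ.2.2.1) hs,
    tendsto_two_pow_mul_exp_logEulerSum_sub (fun _ => qTwo_eq_exp hχ.2.2.1) hs⟩
end
end
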